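/- The function I is strictly decreasing on (0, ∞): for all 0 < ρ₁ < ρ₂ one has I(ρ₂) < I(ρ₁). -/

import Mathlib

open Real Filter MeasureTheory

/-- The arclength-rescaled Möbius energy density integrand of the helix of pitch `ρ`. -/
noncomputable def helixM (ρ t : ℝ) : ℝ :=
  (ρ ^ 2 + 1) / (ρ ^ 2 * t ^ 2 + 4 * Real.sin (t / 2) ^ 2) - 1 / t ^ 2

/-- The arclength-rescaled Möbius energy density of the helix of pitch `ρ`. -/
noncomputable def helixI (ρ : ℝ) : ℝ := ∫ t : ℝ, helixM ρ t

lemma four_mul_sin_half_sq (t : ℝ) : 4 * Real.sin (t / 2) ^ 2 = 2 - 2 * Real.cos t := by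
  have h := Real.cos_sq' (t / 2)
  have h2 := Real.cos_two_mul (t / 2)
  rw [mul_div_cancel₀ t two_ne_zero] at h2
  linarith

lemma four_mul_sin_half_sq_lt {t : ℝ} (ht : t ≠ 0) : 4 * Real.sin (t / 2) ^ 2 < t ^ 2 := by
  rw [four_mul_sin_half_sq]
  linarith [Real.one_sub_sq_div_two_lt_cos ht]

lemma sq_sub_four_mul_sin_half_sq_le (t : ℝ) :
    t ^ 2 - 4 * Real.sin (t / 2) ^ 2 ≤ t ^ 4 := by
  rcases le_total |t| 1 with h | h
  · have hb := (abs_le.mp (Real.cos_bound h)).2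
    rw [show |t| ^ 4 = t ^ 4 from Even.pow_abs (by decide) t] at hb
    rw [four_mul_sin_half_sq]
    linarith [show 0 ≤ t ^ 4 by positivity]
  · have h2 : 1 ≤ t ^ 2 := (one_le_sq_iff_one_le_abs t).mpr h
    nlinarith [sq_nonneg (Real.sin (t / 2))]

lemma helixM_eq {ρ t : ℝ} (hρ : 0 < ρ) (ht : t ≠ 0) :
    helixM ρ t = (t ^ 2 - 4 * Real.sin (t / 2) ^ 2) /
      (t ^ 2 * (ρ ^ 2 * t ^ 2 + 4 * Real.sin (t / 2) ^ 2)) := by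
  have : ρ ^ 2 * t ^ 2 + 4 * Real.sin (t / 2) ^ 2 ≠ 0 := by positivity
  rw [helixM, div_sub_div _ _ this (by positivity)]
  congr 1 <;> ring

lemma abs_helixM_le {ρ : ℝ} (hρ : 0 < ρ) (t : ℝ) :
    |helixM ρ t| ≤ 2 / ρ ^ 2 * (1 + t ^ 2)⁻¹ := by
  rcases eq_or_ne t 0 with rfl | ht
  · simp only [helixM]
    norm_num
    positivity
  have hlt := four_mul_sin_half_sq_lt ht
  have hle := sq_sub_four_mul_sin_half_sq_le t
  have hs : 0 ≤ 4 * Real.sin (t / 2) ^ 2 := by positivity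
  rw [helixM_eq hρ ht]
  generalize 4 * Real.sin (t / 2) ^ 2 = b at *
  rw [abs_of_nonneg (div_nonneg (by linarith) (by positivity)), ← div_eq_mul_inv, div_div,
    div_le_div_iff₀ (by positivity) (by positivity)]
  have key : (t ^ 2 - b) * (1 + t ^ 2) ≤ 2 * t ^ 4 := by nlinarith [sq_nonneg t]
  calc (t ^ 2 - b) * (ρ ^ 2 * (1 + t ^ 2)) = ρ ^ 2 * ((t ^ 2 - b) * (1 + t ^ 2)) := by ring
    _ ≤ ρ ^ 2 * (2 * t ^ 4) := by gcongr
    _ ≤ 2 * (t ^ 2 * (ρ ^ 2 * t ^ 2 + b)) := by nlinarith [mul_nonneg (sq_nonneg t) hs]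

lemma integrable_helixM {ρ : ℝ} (hρ : 0 < ρ) : Integrable (helixM ρ) := by
  refine (integrable_inv_one_add_sq.const_mul (2 / ρ ^ 2)).mono' ?_
    (Eventually.of_forall (abs_helixM_le hρ))
  unfold helixM
  exact Measurable.aestronglyMeasurable (by fun_prop)

lemma helixM_lt_helixM {ρ₁ ρ₂ t : ℝ} (h₁ : 0 < ρ₁) (h₁₂ : ρ₁ < ρ₂) (ht : t ≠ 0) :
    helixM ρ₂ t < helixM ρ₁ t := by
  rw [helixM_eq h₁ ht, helixM_eq (h₁.trans h₁₂) ht]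
  have := sub_pos.mpr (four_mul_sin_half_sq_lt ht)
  gcongr

theorem helixI_strictAnti (ρ₁ ρ₂ : ℝ) (h₁ : 0 < ρ₁) (h₁₂ : ρ₁ < ρ₂) :
    helixI ρ₂ < helixI ρ₁ := by
  have hlt : ∀ᵐ t : ℝ, helixM ρ₂ t < helixM ρ₁ t := by
    filter_upwards [Measure.ae_ne volume (0 : ℝ)] with t ht using helixM_lt_helixM h₁ h₁₂ ht
  have hle : helixM ρ₂ ≤ᵐ[volume] helixM ρ₁ := hlt.mono fun _ h => h.le
  have hi₁ := integrable_helixM h₁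
  have hi₂ := integrable_helixM (h₁.trans h₁₂)
  refine (integral_mono_ae hi₂ hi₁ hle).lt_of_ne fun heq => ?_
  obtain ⟨t, ht, ht'⟩ := (hlt.and ((integral_eq_iff_of_ae_le hi₂ hi₁ hle).mp heq)).exists
  exact ht.ne ht'
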